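/- Let E be a finite-dimensional real normed vector space, let r ≥ 2 be an integer, and let F : E × ℝ → ℝ be a C^r function which is 1-periodic in its second variable. Let x₀ ∈ E and t₀ ∈ ℝ be such that F(x₀,t₀) = sup_{t ∈ ℝ} F(x₀,t), F(x₀,t) < F(x₀,t₀) whenever t − t₀ ∉ ℤ, and the second derivative of t ↦ F(x₀,t) at t₀ is strictly negative. Then there exist an open neighborhood U of x₀ and a C^{r−1} map τ : U → ℝ with τ(x₀) = t₀ such that F(x,τ(x)) = sup_{t ∈ ℝ} F(x,t) for every x ∈ U. -/

import Mathlib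

/-- A continuous linear endomorphism of `ℝ` which does not vanish at `1` is invertible. -/
theorem ContinuousLinearMap.isInvertible_of_apply_one_ne_zero {L : ℝ →L[ℝ] ℝ} (h : L 1 ≠ 0) :
    L.IsInvertible := by
  refine ⟨ContinuousLinearEquiv.unitsEquivAut ℝ (Units.mk0 (L 1) h), ?_⟩
  ext
  simp

/-- The partial derivative in a real second variable as a value of the total derivative. -/
theorem DifferentiableAt.hasDerivAt_prodMk_right {E : Type*} [NormedAddCommGroup E]
    [NormedSpace ℝ E] {f : E × ℝ → ℝ} {x : E} {t : ℝ} (h : DifferentiableAt ℝ f (x, t)) :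
    HasDerivAt (fun s => f (x, s)) (fderiv ℝ f (x, t) (0, 1)) t :=
  h.hasFDerivAt.comp_hasDerivAt t ((hasDerivAt_const t x).prodMk (hasDerivAt_id t))

/-- If a continuous function is periodic with period one in the second variable and has a unique
maximizer `t₀` modulo one at the parameter `x₀`, then at nearby parameters there are maximizers
close to `t₀`. -/
theorem eventually_exists_maximizer_mem_ball {X : Type*} [TopologicalSpace X] {F : X × ℝ → ℝ}
    (hF : Continuous F) (hper : ∀ (x : X) (t : ℝ), F (x, t + 1) = F (x, t)) {x₀ : X} {t₀ : ℝ}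
    (huniq : ∀ t : ℝ, (¬∃ k : ℤ, t - t₀ = (k : ℝ)) → F (x₀, t) < F (x₀, t₀))
    {δ : ℝ} (hδ : 0 < δ) :
    ∀ᶠ x in nhds x₀, ∃ s ∈ Metric.ball t₀ δ, ∀ t : ℝ, F (x, t) ≤ F (x, s) := by
  have hK : IsCompact (Set.Icc (t₀ - 1 / 2) (t₀ + 1 / 2) \ Metric.ball t₀ δ) :=
    isCompact_Icc.diff Metric.isOpen_ball
  have hlt : ∀ᶠ x in nhds x₀, ∀ t ∈ Set.Icc (t₀ - 1 / 2) (t₀ + 1 / 2) \ Metric.ball t₀ δ,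
      F (x, t) < F (x, t₀) := by
    refine hK.eventually_forall_of_forall_eventually fun t ht => ?_
    refine (isOpen_lt (by fun_prop : Continuous fun z : X × ℝ => F (z.1, z.2))
      (by fun_prop : Continuous fun z : X × ℝ => F (z.1, t₀))).mem_nhds (huniq t ?_)
    rintro ⟨k, hk⟩
    obtain ⟨⟨h₁, h₂⟩, h₃⟩ := ht
    have hk₁ : (-1 : ℝ) < k := by linarith
    have hk₂ : (k : ℝ) < 1 := by linarith
    have hk₀ : k = 0 := by
      have : -1 < k := by exact_mod_cast hk₁
      have : k < 1 := by exact_mod_cast hk₂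
      omega
    have : t = t₀ := by
      rw [hk₀, Int.cast_zero] at hk
      linarith
    exact h₃ (this ▸ Metric.mem_ball_self hδ)
  filter_upwards [hlt] with x hx
  have hmem : t₀ ∈ Set.Icc (t₀ - 1 / 2) (t₀ + 1 / 2) := ⟨by linarith, by linarith⟩
  obtain ⟨s, hs, hsmax⟩ := isCompact_Icc.exists_isMaxOn ⟨t₀, hmem⟩
    (by fun_prop : Continuous fun t => F (x, t)).continuousOn
  refine ⟨s, ?_, fun t => ?_⟩
  · by_contra hsδ
    exact (hx s ⟨hs, hsδ⟩).not_ge (hsmax hmem)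
  · have hp : Function.Periodic (fun t => F (x, t)) 1 := hper x
    obtain ⟨t', ht', htt'⟩ := hp.exists_mem_Ico one_pos t (t₀ - 1 / 2)
    have h : F (x, t) = F (x, t') := htt'
    rw [h]
    exact hsmax ⟨ht'.1, by linarith [ht'.2]⟩

/-- If `F : E × ℝ → ℝ` is `C^r` (`r ≥ 2`), `1`-periodic in the second variable, and `t₀` is a
maximizer of `t ↦ F (x₀, t)`, unique modulo `1`, at which the second derivative is strictly
negative, then on some open neighborhood `U` of `x₀` there is a `C^{r-1}` selection
`τ : U → ℝ` of maximizers with `τ x₀ = t₀`. -/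
theorem stmt2 {E : Type*} [NormedAddCommGroup E] [NormedSpace ℝ E] [FiniteDimensional ℝ E]
    (r : ℕ) (hr : 2 ≤ r) (F : E × ℝ → ℝ) (hF : ContDiff ℝ r F)
    (hper : ∀ (x : E) (t : ℝ), F (x, t + 1) = F (x, t))
    (x₀ : E) (t₀ : ℝ)
    (hmax : ∀ t : ℝ, F (x₀, t) ≤ F (x₀, t₀))
    (huniq : ∀ t : ℝ, (¬∃ k : ℤ, t - t₀ = (k : ℝ)) → F (x₀, t) < F (x₀, t₀))
    (hsec : deriv (deriv fun t : ℝ => F (x₀, t)) t₀ < 0) :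
    ∃ U : Set E, IsOpen U ∧ x₀ ∈ U ∧ ∃ τ : E → ℝ,
      ContDiffOn ℝ ((r - 1 : ℕ) : ℕ∞) τ U ∧ τ x₀ = t₀ ∧
      ∀ x ∈ U, ∀ t : ℝ, F (x, t) ≤ F (x, τ x) := by
  have hF1 : Differentiable ℝ F := hF.differentiable (by exact_mod_cast (by omega : r ≠ 0))
  let G : E × ℝ → ℝ := fun z => fderiv ℝ F z (0, 1)
  have hn : (((r - 1 : ℕ) : ℕ∞) : WithTop ℕ∞) ≠ 0 := by exact_mod_cast (by omega : r - 1 ≠ 0)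
  have hG : ContDiff ℝ ((r - 1 : ℕ) : ℕ∞) G := by
    refine (hF.fderiv_right ?_).clm_apply contDiff_const
    exact_mod_cast (by omega : r - 1 + 1 ≤ r)
  have hFG : ∀ x t, HasDerivAt (fun s => F (x, s)) (G (x, t)) t := fun x t =>
    (hF1 (x, t)).hasDerivAt_prodMk_right
  have hGinv : (fderiv ℝ G (x₀, t₀) ∘L .inr ℝ E ℝ).IsInvertible := by
    refine ContinuousLinearMap.isInvertible_of_apply_one_ne_zero ?_
    have hderiv : (deriv fun t : ℝ => F (x₀, t)) = fun t => G (x₀, t) :=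
      funext fun t => (hFG x₀ t).deriv
    rw [hderiv, (hG.differentiable hn (x₀, t₀)).hasDerivAt_prodMk_right.deriv] at hsec
    simpa using hsec.ne
  have hG₀ : G (x₀, t₀) = 0 :=
    IsLocalMax.hasDerivAt_eq_zero (Filter.Eventually.of_forall hmax) (hFG x₀ t₀)
  have cdG : ContDiffAt ℝ ((r - 1 : ℕ) : ℕ∞) G (x₀, t₀) := hG.contDiffAt
  let τ := cdG.implicitFunction hn hGinv
  have hτ : ∀ᶠ x in nhds x₀, ContDiffAt ℝ ((r - 1 : ℕ) : ℕ∞) τ x :=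
    (cdG.contDiffAt_implicitFunction hn hGinv).eventually
      (by exact_mod_cast ENat.natCast_ne_top (r - 1))
  have hτmax : ∀ᶠ x in nhds x₀, ∀ t : ℝ, F (x, t) ≤ F (x, τ x) := by
    have hiff := cdG.eventually_apply_eq_iff_implicitFunction hn hGinv
    rw [nhds_prod_eq] at hiff
    obtain ⟨p, hp, q, hq, hpq⟩ := Filter.eventually_prod_iff.1 hiff
    obtain ⟨δ, hδ, hball⟩ := Metric.eventually_nhds_iff_ball.1 hq
    filter_upwards [hp, eventually_exists_maximizer_mem_ball hF.continuous hper huniq hδ]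
      with x hx ⟨s, hs, hsmax⟩
    have hGs : G (x, s) = 0 :=
      IsLocalMax.hasDerivAt_eq_zero (Filter.Eventually.of_forall hsmax) (hFG x s)
    have hτs : τ x = s := (hpq hx (hball s hs)).1 (hGs.trans hG₀.symm)
    rwa [hτs]
  obtain ⟨U, hU, hUo, hxU⟩ := eventually_nhds_iff.1 (hτ.and hτmax)
  exact ⟨U, hUo, hxU, τ, fun x hx => (hU x hx).1.contDiffWithinAt,
    cdG.implicitFunction_apply_self hn hGinv, fun x hx => (hU x hx).2⟩
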